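/- arXiv:2412.16314 — 3 statements merged into one kernel-verified Lean document; each statement's English description precedes it below -/
import Mathlib

section
/- Let n ≥ 1 be a natural number, and in SL₂(ℤ) let A = [[1, -n], [0, 1]] and B = [[1, 0], [n, 1]], and let Λₙ be the subgroup of SL₂(ℤ) generated by A and B. Then for every γ ∈ Λₙ, the trace of γ is congruent to 2 modulo n². -/
open Matrix

/-- `A = [[1, -n], [0, 1]]` as an element of `SL₂(ℤ)`. -/
def Amat (n : ℕ) : Matrix.SpecialLinearGroup (Fin 2) ℤ :=
  ⟨!![1, -(n:ℤ); 0, 1], by simp [Matrix.det_fin_two_of]⟩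

/-- `B = [[1, 0], [n, 1]]` as an element of `SL₂(ℤ)`. -/
def Bmat (n : ℕ) : Matrix.SpecialLinearGroup (Fin 2) ℤ :=
  ⟨!![1, 0; (n:ℤ), 1], by simp [Matrix.det_fin_two_of]⟩

/-- `Λₙ`, the subgroup of `SL₂(ℤ)` generated by `A` and `B`. -/
def Lam (n : ℕ) : Subgroup (Matrix.SpecialLinearGroup (Fin 2) ℤ) :=
  Subgroup.closure {Amat n, Bmat n}

/-- Elements of `Λₙ` have diagonal entries `≡ 1` modulo `n²` and off-diagonal entries divisible
by `n`. -/
theorem exists_entries_of_mem_Lam {n : ℕ} {γ : Matrix.SpecialLinearGroup (Fin 2) ℤ}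
    (hγ : γ ∈ Lam n) :
    ∃ a b c d : ℤ, (γ : Matrix (Fin 2) (Fin 2) ℤ) =
      !![1 + (n : ℤ) ^ 2 * a, n * b; n * c, 1 + (n : ℤ) ^ 2 * d] := by
  induction hγ using Subgroup.closure_induction with
  | mem x hx =>
    rcases hx with rfl | rfl
    · exact ⟨0, -1, 0, 0, by simp [Amat]⟩
    · exact ⟨0, 0, 1, 0, by simp [Bmat]⟩
  | one => exact ⟨0, 0, 0, 0, by simp [Matrix.one_fin_two]⟩
  | mul x y _ _ hx hy =>
    obtain ⟨a, b, c, d, hx⟩ := hx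
    obtain ⟨a', b', c', d', hy⟩ := hy
    refine ⟨a + a' + n ^ 2 * a * a' + b * c', b' + n ^ 2 * a * b' + b + n ^ 2 * b * d',
      c + n ^ 2 * c * a' + c' + n ^ 2 * d * c', d + d' + n ^ 2 * d * d' + c * b', ?_⟩
    rw [Matrix.SpecialLinearGroup.coe_mul, hx, hy, Matrix.mul_fin_two]
    congr! 3 <;> ring_nf
  | inv x _ hx =>
    obtain ⟨a, b, c, d, hx⟩ := hx
    refine ⟨d, -b, -c, a, ?_⟩
    rw [Matrix.SpecialLinearGroup.coe_inv, hx, Matrix.adjugate_fin_two_of]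
    simp

/-- For every `γ ∈ Λₙ` (with `n ≥ 1`), the trace of `γ` is congruent to `2` modulo `n²`. -/
theorem stmt_4 (n : ℕ) (hn : 1 ≤ n) :
    ∀ γ ∈ Lam n,
      Matrix.trace (γ : Matrix (Fin 2) (Fin 2) ℤ) ≡ 2 [ZMOD (n : ℤ) ^ 2] := by
  intro γ hγ
  obtain ⟨a, b, c, d, h⟩ := exists_entries_of_mem_Lam hγ
  rw [h, Matrix.trace_fin_two_of]
  exact (Int.modEq_iff_dvd.mpr ⟨a + d, by ring⟩).symm
end

section
/- Let n ≥ 3 be a natural number, and in SL₂(ℤ) let A = [[1, -n], [0, 1]] and B = [[1, 0], [n, 1]], and let Λₙ be the subgroup of SL₂(ℤ) generated by A and B. Then for every γ ∈ Λₙ with |tr γ| > 2, the characteristic polynomial of γ (viewed as a polynomial over ℝ) has a real root λ with |λ| ≥ (n² - 2 + n·√(n² - 4))/2. -/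
open Matrix Polynomial

/-- Diagonal entries of elements of `Λₙ` are `1` modulo `n²`, off-diagonal ones `0` modulo `n`. -/
theorem Lam_entries_congr {n : ℕ} {γ : Matrix.SpecialLinearGroup (Fin 2) ℤ} (hγ : γ ∈ Lam n) :
    ((n : ℤ) ^ 2 ∣ γ 0 0 - 1 ∧ (n : ℤ) ^ 2 ∣ γ 1 1 - 1) ∧ (n : ℤ) ∣ γ 0 1 ∧ (n : ℤ) ∣ γ 1 0 := by
  induction hγ using Subgroup.closure_induction with
  | mem x hx =>
    rcases hx with rfl | rfl <;> simp [Amat, Bmat]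
  | one => simp
  | mul x y _ _ hx hy =>
    obtain ⟨⟨⟨a, ha⟩, d, hd⟩, ⟨b, hb⟩, c, hc⟩ := hx
    obtain ⟨⟨⟨a', ha'⟩, d', hd'⟩, ⟨b', hb'⟩, c', hc'⟩ := hy
    rw [sub_eq_iff_eq_add] at ha hd ha' hd'
    simp only [Matrix.SpecialLinearGroup.coe_mul, Matrix.mul_apply, Fin.sum_univ_two,
      ha, hb, hc, hd, ha', hb', hc', hd']
    refine ⟨⟨⟨n ^ 2 * a * a' + a + a' + b * c', by ring⟩,
      ⟨n ^ 2 * d * d' + d + d' + c * b', by ring⟩⟩,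
      ⟨(n ^ 2 * a + 1) * b' + b * (n ^ 2 * d' + 1), by ring⟩,
      ⟨c * (n ^ 2 * a' + 1) + (n ^ 2 * d + 1) * c', by ring⟩⟩
  | inv x _ hx =>
    simpa [Matrix.SpecialLinearGroup.coe_inv, Matrix.adjugate_fin_two, and_comm] using hx

/-- The trace of an element of `Λₙ` is `2` modulo `n²`. -/
theorem Lam_sq_dvd_trace_sub_two {n : ℕ} {γ : Matrix.SpecialLinearGroup (Fin 2) ℤ}
    (hγ : γ ∈ Lam n) :
    (n : ℤ) ^ 2 ∣ Matrix.trace (γ : Matrix (Fin 2) (Fin 2) ℤ) - 2 := by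
  obtain ⟨⟨ha, hd⟩, -⟩ := Lam_entries_congr hγ
  rw [Matrix.trace_fin_two]
  have h := dvd_add ha hd
  rwa [sub_add_sub_comm, one_add_one_eq_two] at h

/-- A hyperbolic element of `Λₙ` has trace at least `n² - 2` in absolute value. -/
theorem Lam_le_abs_trace {n : ℕ} {γ : Matrix.SpecialLinearGroup (Fin 2) ℤ} (hγ : γ ∈ Lam n)
    (h : 2 < |Matrix.trace (γ : Matrix (Fin 2) (Fin 2) ℤ)|) :
    (n : ℤ) ^ 2 - 2 ≤ |Matrix.trace (γ : Matrix (Fin 2) (Fin 2) ℤ)| := by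
  have hne : Matrix.trace (γ : Matrix (Fin 2) (Fin 2) ℤ) - 2 ≠ 0 := by
    intro h0
    rw [sub_eq_zero.mp h0] at h
    norm_num at h
  have hle := Int.le_of_dvd (abs_pos.mpr hne)
    ((dvd_abs _ _).mpr (Lam_sq_dvd_trace_sub_two hγ))
  have := abs_sub (Matrix.trace (γ : Matrix (Fin 2) (Fin 2) ℤ)) 2
  rw [abs_two] at this
  linarith

/-- If `2 ≤ |t|`, then `x² - t x + 1` has a real root of absolute value `(|t| + √(t² - 4)) / 2`. -/
theorem exists_root_abs_eq {t : ℝ} (ht : 2 ≤ |t|) :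
    ∃ x : ℝ, x ^ 2 - t * x + 1 = 0 ∧ |x| = (|t| + √(t ^ 2 - 4)) / 2 := by
  have hs : √(t ^ 2 - 4) ^ 2 = t ^ 2 - 4 :=
    Real.sq_sqrt (by nlinarith [sq_abs t])
  have h0 := Real.sqrt_nonneg (t ^ 2 - 4)
  rcases le_total 0 t with h | h
  · refine ⟨(t + √(t ^ 2 - 4)) / 2, by linear_combination hs / 4, ?_⟩
    rw [abs_of_nonneg (by positivity), abs_of_nonneg h]
  · refine ⟨(t - √(t ^ 2 - 4)) / 2, by linear_combination hs / 4, ?_⟩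
    rw [abs_of_nonpos (by linarith), abs_of_nonpos h]
    ring

/-- For every hyperbolic `γ ∈ Λₙ` (with `n ≥ 3`), the characteristic polynomial of `γ`
over `ℝ` has a real root `λ` with `|λ| ≥ (n² - 2 + n·√(n² - 4))/2`. -/
theorem stmt_9 (n : ℕ) (hn : 3 ≤ n) :
    ∀ γ ∈ Lam n, 2 < |Matrix.trace (γ : Matrix (Fin 2) (Fin 2) ℤ)| →
      ∃ lam : ℝ,
        (((γ : Matrix (Fin 2) (Fin 2) ℤ)).map (Int.cast : ℤ → ℝ)).charpoly.IsRoot lam ∧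
        ((n : ℝ) ^ 2 - 2 + (n : ℝ) * Real.sqrt ((n : ℝ) ^ 2 - 4)) / 2 ≤ |lam| := by
  intro γ hγ htr
  have hle := Lam_le_abs_trace hγ htr
  set M : Matrix (Fin 2) (Fin 2) ℤ := γ.1 with hM
  have htrR : (2 : ℝ) ≤ |(M.trace : ℝ)| := by exact_mod_cast htr.le
  have hleR : (n : ℝ) ^ 2 - 2 ≤ |(M.trace : ℝ)| := by exact_mod_cast hle
  obtain ⟨x, hx, habs⟩ := exists_root_abs_eq htrR
  have hn' : (3 : ℝ) ≤ n := by exact_mod_cast hn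
  refine ⟨x, ?_, ?_⟩
  · have hdet : (M.map (Int.cast : ℤ → ℝ)).det = 1 := by
      have h := Int.cast_det (R := ℝ) M
      rw [hM, γ.det_coe, Int.cast_one] at h
      exact h.symm
    have htrace : (M.map (Int.cast : ℤ → ℝ)).trace = M.trace := by
      simp [Matrix.trace_fin_two]
    rw [Polynomial.IsRoot, Matrix.charpoly_fin_two, hdet, htrace]
    simpa using hx
  · have hsqrt : (n : ℝ) * √((n : ℝ) ^ 2 - 4) ≤ √((M.trace : ℝ) ^ 2 - 4) := by
      apply Real.le_sqrt_of_sq_le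
      rw [mul_pow, Real.sq_sqrt (by nlinarith)]
      nlinarith [sq_abs (M.trace : ℝ)]
    rw [habs]
    linarith
end

section
/- Let n ≥ 3 be a natural number, and in SL₂(ℤ) let A = [[1, -n], [0, 1]] and B = [[1, 0], [n, 1]], and let Λₙ be the subgroup of SL₂(ℤ) generated by A and B. Then A·B and B·A are conjugate in Λₙ (indeed B·A = B·(A·B)·B⁻¹), and both have trace 2 - n²; hence both realize the minimal trace magnitude n² - 2 among hyperbolic elements of Λₙ. -/
open Matrix

/-- Elements of `Λₙ` have diagonal entries `≡ 1 mod n²` and off-diagonal entries `≡ 0 mod n`. -/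
theorem Lam_entries (n : ℕ) {γ : Matrix.SpecialLinearGroup (Fin 2) ℤ} (hγ : γ ∈ Lam n) :
    (∃ x, γ 0 0 = 1 + (n : ℤ) ^ 2 * x) ∧ (∃ x, γ 0 1 = (n : ℤ) * x) ∧
      (∃ x, γ 1 0 = (n : ℤ) * x) ∧ ∃ x, γ 1 1 = 1 + (n : ℤ) ^ 2 * x := by
  induction hγ using Subgroup.closure_induction with
  | mem x hx =>
    rcases hx with rfl | rfl
    · exact ⟨⟨0, by simp [Amat]⟩, ⟨-1, by simp [Amat]⟩, ⟨0, by simp [Amat]⟩, ⟨0, by simp [Amat]⟩⟩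
    · exact ⟨⟨0, by simp [Bmat]⟩, ⟨0, by simp [Bmat]⟩, ⟨1, by simp [Bmat]⟩, ⟨0, by simp [Bmat]⟩⟩
  | one => exact ⟨⟨0, by simp⟩, ⟨0, by simp⟩, ⟨0, by simp⟩, ⟨0, by simp⟩⟩
  | mul x y _ _ hx hy =>
    obtain ⟨⟨a, ha⟩, ⟨b, hb⟩, ⟨c, hc⟩, ⟨d, hd⟩⟩ := hx
    obtain ⟨⟨a', ha'⟩, ⟨b', hb'⟩, ⟨c', hc'⟩, ⟨d', hd'⟩⟩ := hy
    simp only [Matrix.SpecialLinearGroup.coe_mul, Matrix.mul_apply, Fin.sum_univ_two,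
      ha, hb, hc, hd, ha', hb', hc', hd']
    exact ⟨⟨a + a' + (n : ℤ) ^ 2 * a * a' + b * c', by ring⟩,
      ⟨(1 + (n : ℤ) ^ 2 * a) * b' + b * (1 + (n : ℤ) ^ 2 * d'), by ring⟩,
      ⟨c * (1 + (n : ℤ) ^ 2 * a') + (1 + (n : ℤ) ^ 2 * d) * c', by ring⟩,
      ⟨d + d' + (n : ℤ) ^ 2 * d * d' + c * b', by ring⟩⟩
  | inv x _ hx =>
    obtain ⟨ha, ⟨b, hb⟩, ⟨c, hc⟩, hd⟩ := hx
    rw [Matrix.SpecialLinearGroup.SL2_inv_expl]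
    exact ⟨by simpa using hd, ⟨-b, by simp [hb]⟩, ⟨-c, by simp [hc]⟩, by simpa using ha⟩

theorem Lam_trace (n : ℕ) {γ : Matrix.SpecialLinearGroup (Fin 2) ℤ} (hγ : γ ∈ Lam n) :
    ∃ k, Matrix.trace (γ : Matrix (Fin 2) (Fin 2) ℤ) = 2 + (n : ℤ) ^ 2 * k := by
  obtain ⟨⟨a, ha⟩, -, -, ⟨d, hd⟩⟩ := Lam_entries n hγ
  exact ⟨a + d, by rw [Matrix.trace_fin_two, ha, hd]; ring⟩

theorem trace_Amat_mul_Bmat (n : ℕ) :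
    Matrix.trace ((Amat n * Bmat n : Matrix.SpecialLinearGroup (Fin 2) ℤ) :
      Matrix (Fin 2) (Fin 2) ℤ) = 2 - (n : ℤ) ^ 2 := by
  rw [Matrix.SpecialLinearGroup.coe_mul, Matrix.trace_fin_two]
  simp only [Amat, Bmat, Matrix.mul_apply, Fin.sum_univ_two, Matrix.of_apply, Matrix.cons_val]
  ring

theorem trace_Bmat_mul_Amat (n : ℕ) :
    Matrix.trace ((Bmat n * Amat n : Matrix.SpecialLinearGroup (Fin 2) ℤ) :
      Matrix (Fin 2) (Fin 2) ℤ) = 2 - (n : ℤ) ^ 2 := by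
  rw [Matrix.SpecialLinearGroup.coe_mul, Matrix.trace_mul_comm,
    ← Matrix.SpecialLinearGroup.coe_mul, trace_Amat_mul_Bmat]

/-- `A·B` and `B·A` are conjugate in `Λₙ` (indeed `B·A = B·(A·B)·B⁻¹`), both have trace
`2 - n²`, and both realize the minimal trace magnitude `n² - 2` among hyperbolic elements
of `Λₙ`. -/
theorem stmt_14 (n : ℕ) (hn : 3 ≤ n) :
    Amat n * Bmat n ∈ Lam n ∧
    Bmat n * Amat n ∈ Lam n ∧
    Bmat n * Amat n = Bmat n * (Amat n * Bmat n) * (Bmat n)⁻¹ ∧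
    Matrix.trace ((Amat n * Bmat n : Matrix.SpecialLinearGroup (Fin 2) ℤ) :
        Matrix (Fin 2) (Fin 2) ℤ) = 2 - (n : ℤ) ^ 2 ∧
    Matrix.trace ((Bmat n * Amat n : Matrix.SpecialLinearGroup (Fin 2) ℤ) :
        Matrix (Fin 2) (Fin 2) ℤ) = 2 - (n : ℤ) ^ 2 ∧
    |Matrix.trace ((Amat n * Bmat n : Matrix.SpecialLinearGroup (Fin 2) ℤ) :
        Matrix (Fin 2) (Fin 2) ℤ)| = (n : ℤ) ^ 2 - 2 ∧
    |Matrix.trace ((Bmat n * Amat n : Matrix.SpecialLinearGroup (Fin 2) ℤ) :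
        Matrix (Fin 2) (Fin 2) ℤ)| = (n : ℤ) ^ 2 - 2 ∧
    2 < (n : ℤ) ^ 2 - 2 ∧
    ∀ γ ∈ Lam n, 2 < |Matrix.trace (γ : Matrix (Fin 2) (Fin 2) ℤ)| →
      (n : ℤ) ^ 2 - 2 ≤ |Matrix.trace (γ : Matrix (Fin 2) (Fin 2) ℤ)| := by
  have hA : Amat n ∈ Lam n := Subgroup.subset_closure (by simp)
  have hB : Bmat n ∈ Lam n := Subgroup.subset_closure (by simp)
  have hn' : (3 : ℤ) ≤ n := by exact_mod_cast hn
  have hsq : (9 : ℤ) ≤ (n : ℤ) ^ 2 := by nlinarith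
  have habs : |2 - (n : ℤ) ^ 2| = (n : ℤ) ^ 2 - 2 := by
    rw [abs_of_nonpos (by linarith)]
    ring
  refine ⟨mul_mem hA hB, mul_mem hB hA, by group, trace_Amat_mul_Bmat n, trace_Bmat_mul_Amat n,
    by rw [trace_Amat_mul_Bmat, habs], by rw [trace_Bmat_mul_Amat, habs], by linarith, ?_⟩
  intro γ hγ hhyp
  obtain ⟨k, hk⟩ := Lam_trace n hγ
  rw [hk] at hhyp ⊢
  rcases lt_trichotomy k 0 with h | rfl | h
  · exact le_abs.2 (Or.inr (by nlinarith))
  · simp at hhyp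
  · exact le_abs.2 (Or.inl (by nlinarith))
end
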